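/- Let p be a prime with p ≡ 3 (mod 4) and p ≥ 7, and write m = p − 1 = 2r with r ≥ 3 odd. Define the period-m sequence s : ℤ → F_p by s_n = (−1)^n·(n+1) for 0 ≤ n ≤ r−1 and s_{r+i} = (−1)^{i+1}·(r−i) for 0 ≤ i ≤ r−1 (so s_0, …, s_{m−1} = 1, −2, 3, …, −(r−1), r, −r, r−1, −(r−2), …, 2, −1, taken modulo p). Then {s_0, …, s_{m−1}} = F_p^*, the m-th cyclotomic polynomial Φ_m over F_p divides s̃(x) = Σ_{i=0}^{m−1} s_i x^{m−1−i}, and the minimal recursion of s is f_s(x) = (x + 1)(x^r − 1)/(x − 1) = (x+1)(x^{r−1} + x^{r−2} + ⋯ + x + 1). In particular, F_p^* is an automatically non-standard f-subgroup for f(x) = (x + 1)(x^r − 1)/(x − 1). -/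

import Mathlib

open Polynomial

/-- `lrsApply f s` is the sequence `f(σ)s`, where `σ` is the left-shift operator:
`(f(σ)s)_n = ∑_i (coeff of x^i in f) * s_{n+i}`. -/
noncomputable def lrsApply {F : Type*} [CommRing F] (f : Polynomial F) (s : ℤ → F) : ℤ → F :=
  fun n => ∑ i ∈ Finset.range (f.natDegree + 1), f.coeff i * s (n + i)

section LinearRecurrence

variable {F : Type*} [CommRing F]

/-- The left-shift operator on two-sided sequences. -/
noncomputable def leftShift (F : Type*) [CommRing F] : Module.End F (ℤ → F) :=
  LinearMap.funLeft F F fun n => n + 1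

theorem leftShift_apply (s : ℤ → F) (n : ℤ) : leftShift F s n = s (n + 1) := rfl

theorem leftShift_pow_apply (s : ℤ → F) (i : ℕ) (n : ℤ) :
    (leftShift F ^ i) s n = s (n + i) := by
  induction i generalizing n with
  | zero => simp
  | succ i ih =>
    rw [pow_succ', Module.End.mul_apply, leftShift_apply, ih]
    push_cast
    ring_nf

theorem lrsApply_eq_aeval (g : F[X]) (s : ℤ → F) :
    lrsApply g s = aeval (leftShift F) g s := by
  ext n
  simp [lrsApply, aeval_eq_sum_range, leftShift_pow_apply]

/-- The value at `z` of the polynomial `∑ i < m, s i * X ^ (m - 1 - i)` attached to a sequence,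
as a linear functional of the sequence. -/
noncomputable def periodSum (m : ℕ) (z : F) : (ℤ → F) →ₗ[F] F where
  toFun s := ∑ i ∈ Finset.range m, s i * z ^ (m - 1 - i)
  map_add' s t := by simp [add_mul, Finset.sum_add_distrib]
  map_smul' c s := by simp [Finset.mul_sum, mul_assoc]

theorem periodSum_apply (m : ℕ) (z : F) (s : ℤ → F) :
    periodSum m z s = ∑ i ∈ Finset.range m, s i * z ^ (m - 1 - i) := rfl

theorem periodSum_leftShift {m : ℕ} {z : F} (hz : z ^ m = 1) {s : ℤ → F}
    (hs : ∀ n : ℤ, s (n + m) = s n) :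
    periodSum m z (leftShift F s) = z * periodSum m z s := by
  have h : z * periodSum m z s = ∑ i ∈ Finset.range m, s i * z ^ (m - i) := by
    rw [periodSum_apply, Finset.mul_sum]
    refine Finset.sum_congr rfl fun i hi => ?_
    have hi := Finset.mem_range.1 hi
    rw [show m - i = m - 1 - i + 1 by omega, pow_succ]
    ring
  have h0 : s (m : ℤ) = s 0 := by simpa using hs 0
  have h1 := Finset.sum_range_succ (fun i : ℕ => s i * z ^ (m - i)) m
  rw [Finset.sum_range_succ'] at h1
  simp only [Nat.cast_zero, Nat.sub_zero, hz, Nat.sub_self, pow_zero, h0, add_left_inj] at h1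
  rw [h, ← h1, periodSum_apply]
  refine Finset.sum_congr rfl fun i _ => ?_
  rw [leftShift_apply, show m - 1 - i = m - (i + 1) by omega]
  push_cast
  rfl

theorem periodSum_leftShift_pow {m : ℕ} {z : F} (hz : z ^ m = 1) {s : ℤ → F}
    (hs : ∀ n : ℤ, s (n + m) = s n) (i : ℕ) :
    periodSum m z ((leftShift F ^ i) s) = z ^ i * periodSum m z s := by
  induction i with
  | zero => simp
  | succ i ih =>
    rw [pow_succ', Module.End.mul_apply, periodSum_leftShift hz, ih]
    · ring
    · intro n
      rw [leftShift_pow_apply, leftShift_pow_apply, ← hs (n + i)]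
      ring_nf

theorem periodSum_lrsApply {m : ℕ} {z : F} (hz : z ^ m = 1) {s : ℤ → F}
    (hs : ∀ n : ℤ, s (n + m) = s n) (g : F[X]) :
    periodSum m z (lrsApply g s) = g.eval z * periodSum m z s := by
  rw [lrsApply_eq_aeval, aeval_eq_sum_range, eval_eq_sum_range, Finset.sum_mul,
    LinearMap.sum_apply, map_sum]
  refine Finset.sum_congr rfl fun i _ => ?_
  rw [LinearMap.smul_apply, map_smul, periodSum_leftShift_pow hz hs, smul_eq_mul, mul_assoc]

end LinearRecurrence

section Roots

variable {F : Type*} [Field F]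

theorem dvd_of_dvd_X_pow_sub_one {m : ℕ} (hm : (m : F) ≠ 0) (hsplit : (X ^ m - 1 : F[X]).Splits)
    {f g : F[X]} (hf : f ∣ X ^ m - 1) (h : ∀ z, f.IsRoot z → g.IsRoot z) : f ∣ g := by
  have hne : (X ^ m - 1 : F[X]) ≠ 0 := (separable_X_pow_sub_C (1 : F) hm one_ne_zero).ne_zero
  have hf0 : f ≠ 0 := ne_zero_of_dvd_ne_zero hne hf
  rcases eq_or_ne g 0 with rfl | hg
  · exact dvd_zero f
  have hsep : f.Separable := (by simpa using separable_X_pow_sub_C (1 : F) hm one_ne_zero :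
    (X ^ m - 1 : F[X]).Separable).of_dvd hf
  refine (hsplit.of_dvd hne hf).dvd_of_roots_le_roots hf0 ?_
  rw [Multiset.le_iff_subset (nodup_roots hsep)]
  intro z hz
  exact (mem_roots hg).2 (h z ((mem_roots hf0).1 hz))

theorem cyclotomic_mul_dvd {r : ℕ} (hr : Odd r) (hr3 : 3 ≤ r) :
    (X - 1) * cyclotomic (2 * r) F * ((X + 1) * ∑ i ∈ Finset.range r, X ^ i) ∣
      X ^ (2 * r) - 1 := by
  have h2 : 2 ∉ r.divisors := fun h =>
    (Nat.not_even_iff_odd.2 hr) (even_iff_two_dvd.2 (Nat.dvd_of_mem_divisors h))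
  have h2r : 2 * r ∉ insert 2 r.divisors := by
    rw [Finset.mem_insert]
    rintro (h | h)
    · omega
    · have := Nat.divisor_le h
      omega
  have hsub : insert (2 * r) (insert 2 r.divisors) ⊆ (2 * r).divisors := by
    intro d hd
    rw [Nat.mem_divisors]
    refine ⟨?_, by omega⟩
    simp only [Finset.mem_insert, Nat.mem_divisors] at hd
    rcases hd with rfl | rfl | hd
    · exact dvd_rfl
    · exact dvd_mul_right _ _
    · exact hd.1.mul_left 2
  have h := Finset.prod_dvd_prod_of_subset _ _ (fun d => cyclotomic d F) hsub
  rw [Finset.prod_insert h2r, Finset.prod_insert h2, prod_cyclotomic_eq_X_pow_sub_one (by omega),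
    prod_cyclotomic_eq_X_pow_sub_one (by omega), cyclotomic_two] at h
  convert h using 1
  rw [← geom_sum_mul]
  ring

end Roots

section ZigzagSequence

variable {F : Type*} [CommRing F] {r : ℕ} {s : ℤ → F}

/-- The `2r`-periodic sequence `1, -2, 3, …, -(r-1), r, -r, r-1, …, 2, -1`. -/
structure IsZigzag (r : ℕ) (s : ℤ → F) : Prop where
  odd : Odd r
  periodic : ∀ n : ℤ, s (n + (2 * r : ℕ)) = s n
  apply_of_lt : ∀ k : ℕ, k < r → s k = (-1) ^ k * (k + 1)
  apply_add_of_lt : ∀ k : ℕ, k < r → s (r + k) = (-1) ^ (k + 1) * (r - k)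

/-- The sequence `(σ + 1)s` of sums of adjacent terms of `s`. -/
noncomputable def pairSum (s : ℤ → F) : ℤ → F :=
  leftShift F s + s

theorem pairSum_apply (s : ℤ → F) (n : ℤ) : pairSum s n = s (n + 1) + s n := rfl

theorem natCast_succ_ne_zero {p : ℕ} (hp : p = 2 * r + 1) {k : ℕ} (hk : k < r) :
    (k + 1 : ZMod p) ≠ 0 := by
  intro h0
  have h1 : ((k + 1 : ℕ) : ZMod p) = 0 := by exact_mod_cast h0
  have := Nat.le_of_dvd (by omega) ((ZMod.natCast_eq_zero_iff _ _).1 h1)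
  omega

namespace IsZigzag

theorem pairSum_of_lt (h : IsZigzag r s) {k : ℕ} (hk : k + 1 < r) :
    pairSum s k = (-1) ^ (k + 1) := by
  have h1 := h.apply_of_lt (k + 1) hk
  push_cast at h1
  simp only [pairSum_apply]
  rw [h1, h.apply_of_lt k (by omega)]
  ring

theorem pairSum_last (h : IsZigzag r s) {k : ℕ} (hk : k + 1 = r) :
    pairSum s k = 0 := by
  have h1 := h.apply_add_of_lt 0 (by omega)
  have hodd := h.odd
  rw [← hk, Nat.odd_add_one, Nat.not_odd_iff_even] at hodd
  have h2 : (r : F) = k + 1 := by rw [← hk]; push_cast; rfl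
  have h3 : ((r : ℕ) : ℤ) = k + 1 := by rw [← hk]; push_cast; rfl
  simp only [Nat.cast_zero, add_zero, h3, h2] at h1
  simp only [pairSum_apply]
  rw [h1, h.apply_of_lt k (by omega), hodd.neg_one_pow]
  ring

theorem pairSum_add (h : IsZigzag r s) {k : ℕ} (hk : k < r) :
    pairSum s (k + r) = pairSum s k := by
  rcases Nat.lt_or_ge (k + 1) r with hk1 | hk1
  · rw [h.pairSum_of_lt hk1]
    have h1 := h.apply_add_of_lt (k + 1) hk1
    push_cast at h1
    simp only [pairSum_apply]
    rw [show (k + r + 1 : ℤ) = r + (k + 1) by ring, h1, add_comm (k : ℤ),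
      h.apply_add_of_lt k hk]
    ring
  · have hk2 : k + 1 = r := by omega
    rw [h.pairSum_last hk2]
    have h0 := h.periodic 0
    have h1 := h.apply_of_lt 0 (by omega)
    have h2 : (r : F) = k + 1 := by rw [← hk2]; push_cast; rfl
    have h3 : ((r : ℕ) : ℤ) = k + 1 := by rw [← hk2]; push_cast; rfl
    simp only [pairSum_apply]
    rw [show (k + r + 1 : ℤ) = 0 + (2 * r : ℕ) by push_cast; rw [h3]; ring, h0, add_comm (k : ℤ),
      h.apply_add_of_lt k hk, hk2, h.odd.neg_one_pow, h2]
    simpa [add_neg_eq_zero] using h1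

theorem pairSum_periodic (h : IsZigzag r s) (n : ℤ) :
    pairSum s (n + r) = pairSum s n := by
  have hr : 0 < r := h.odd.pos
  have hper : Function.Periodic (pairSum s) ((2 * r : ℕ) : ℤ) := by
    intro n
    simp only [pairSum_apply]
    rw [h.periodic, add_right_comm, h.periodic]
  have hmod (n : ℤ) : pairSum s n = pairSum s (n % ((2 * r : ℕ) : ℤ)) := by
    conv_lhs => rw [← Int.emod_add_mul_ediv n ((2 * r : ℕ) : ℤ), mul_comm ((2 * r : ℕ) : ℤ)]
    exact hper.int_mul _ _
  obtain ⟨k, hk⟩ := Int.eq_ofNat_of_zero_le (Int.emod_nonneg n (b := ((2 * r : ℕ) : ℤ)) (by omega))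
  have hlt := Int.emod_lt_of_pos n (b := ((2 * r : ℕ) : ℤ)) (by omega)
  have hl : pairSum s (n + r) = pairSum s ((k : ℤ) + r) := by
    rw [hmod, hmod (k + r), ← hk, Int.emod_add_emod]
  rw [hl, hmod n, hk]
  rcases Nat.lt_or_ge k r with hkr | hkr
  · exact h.pairSum_add hkr
  · obtain ⟨j, rfl⟩ := Nat.exists_eq_add_of_le' hkr
    have hj := h.pairSum_add (k := j) (by omega)
    have := hper j
    push_cast at this ⊢
    rw [hj, ← this]
    congr 1
    ring

theorem sum_pairSum (h : IsZigzag r s) (n : ℤ) :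
    ∑ i ∈ Finset.range r, pairSum s (n + i) = 0 := by
  have hstep (n : ℤ) : ∑ i ∈ Finset.range r, pairSum s (n + 1 + i) =
      ∑ i ∈ Finset.range r, pairSum s (n + i) := by
    have h1 := Finset.sum_range_succ (fun i : ℕ => pairSum s (n + i)) r
    rw [Finset.sum_range_succ', h.pairSum_periodic] at h1
    simp only [Nat.cast_zero, add_zero, add_left_inj] at h1
    rw [← h1]
    refine Finset.sum_congr rfl fun i _ => ?_
    push_cast
    rw [add_right_comm, add_assoc]
  have hconst : Function.Periodic (fun n : ℤ => ∑ i ∈ Finset.range r, pairSum s (n + i)) 1 := hstep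
  have h0 := hconst.int_mul n 0
  simp only [zero_add, mul_one, Int.cast_id] at h0
  rw [h0]
  obtain ⟨k, hk⟩ := h.odd
  rw [hk, Finset.sum_range_succ, h.pairSum_last hk.symm, add_zero,
    Finset.sum_congr rfl fun i hi => h.pairSum_of_lt (by have := Finset.mem_range.1 hi; omega)]
  simp_rw [pow_succ]
  rw [← Finset.sum_mul, neg_one_geom_sum, if_pos (even_two_mul k), zero_mul]

theorem lrsApply_eq_zero (h : IsZigzag r s) :
    lrsApply ((X + 1) * ∑ i ∈ Finset.range r, X ^ i) s = 0 := by
  rw [lrsApply_eq_aeval, mul_comm, map_mul, Module.End.mul_apply]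
  ext n
  have h1 : aeval (leftShift F) (X + 1 : F[X]) s = pairSum s := by simp [pairSum]
  rw [h1]
  simpa [leftShift_pow_apply] using h.sum_pairSum n

theorem sq_mul_periodSum (h : IsZigzag r s) {z : F} (hz : z ^ (2 * r) = 1) :
    (z + 1) ^ 2 * periodSum (2 * r) z s = (z ^ r + 1) * (z - z ^ r) := by
  have h1 : periodSum (2 * r) z (pairSum s) = (z + 1) * periodSum (2 * r) z s := by
    rw [pairSum, map_add, periodSum_leftShift hz h.periodic]
    ring
  have h2 : periodSum (2 * r) z (pairSum s) = (z ^ r + 1) * periodSum r z (pairSum s) := by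
    rw [periodSum_apply, periodSum_apply, two_mul, Finset.sum_range_add, add_mul, one_mul,
      Finset.mul_sum]
    congr 1
    · refine Finset.sum_congr rfl fun i hi => ?_
      have hi := Finset.mem_range.1 hi
      rw [show r + r - 1 - i = r + (r - 1 - i) by omega, pow_add]
      ring
    · refine Finset.sum_congr rfl fun i hi => ?_
      rw [show r + r - 1 - (r + i) = r - 1 - i by omega]
      push_cast
      rw [add_comm (r : ℤ), h.pairSum_periodic]
  have h3 : (z + 1) * periodSum r z (pairSum s) = z - z ^ r := by
    obtain ⟨k, hk⟩ := h.odd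
    have h4 : periodSum r z (pairSum s) =
        -z * ∑ i ∈ Finset.range (2 * k), (-1) ^ i * z ^ (2 * k - 1 - i) := by
      rw [periodSum_apply, hk, Finset.sum_range_succ, h.pairSum_last hk.symm, zero_mul, add_zero,
        Finset.mul_sum]
      refine Finset.sum_congr rfl fun i hi => ?_
      have hi := Finset.mem_range.1 hi
      rw [h.pairSum_of_lt (by omega), show 2 * k + 1 - 1 - i = 2 * k - 1 - i + 1 by omega]
      ring
    have h5 := (Commute.all (-1 : F) z).geom_sum₂_mul (2 * k)
    rw [(even_two_mul k).neg_one_pow] at h5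
    rw [h4, hk, pow_succ]
    linear_combination z * h5
  rw [sq, mul_assoc, ← h1, h2, ← h3]
  ring

theorem periodSum_neg_one (h : IsZigzag r s) :
    periodSum (2 * r) (-1) s = -(r * (r + 1)) := by
  have hsq (i : ℕ) : ((-1 : F) ^ i) * (-1) ^ i = 1 := by rw [← mul_pow]; simp
  have key : ∀ i : ℕ, i < 2 * r → (-1 : F) ^ (2 * r - 1 - i) = -(-1) ^ i := by
    intro i hi
    have h1 : (-1 : F) ^ (2 * r - 1 - i) * ((-1) ^ i * (-1)) = 1 := by
      rw [← pow_succ, ← pow_add, show 2 * r - 1 - i + (i + 1) = 2 * r by omega,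
        (even_two_mul r).neg_one_pow]
    linear_combination (-(-1 : F) ^ i) * h1 - (-1 : F) ^ (2 * r - 1 - i) * hsq i
  rw [periodSum_apply, two_mul, Finset.sum_range_add, ← two_mul, ← Finset.sum_add_distrib,
    Finset.sum_congr rfl (g := fun _ => -((r : F) + 1)), Finset.sum_const, Finset.card_range,
    nsmul_eq_mul]
  · ring
  · intro i hi
    have hi := Finset.mem_range.1 hi
    rw [key i (by omega), key (r + i) (by omega), h.apply_of_lt i hi, pow_add, h.odd.neg_one_pow]
    push_cast
    rw [h.apply_add_of_lt i hi]
    linear_combination (-(r : F) - 1) * hsq i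

theorem apply_reflect (h : IsZigzag r s) {k : ℕ} (hk : k < r) :
    s ((2 * r - 1 - k : ℕ) : ℤ) = -((-1) ^ k * (k + 1)) := by
  obtain ⟨j, rfl⟩ : ∃ j, r = k + 1 + j := Nat.exists_eq_add_of_le hk
  have h1 := h.apply_add_of_lt j (by omega)
  rw [show 2 * (k + 1 + j) - 1 - k = (k + 1 + j) + j by omega]
  push_cast at h1 ⊢
  rw [h1]
  have hodd := h.odd
  have h2 : (-1 : F) ^ (j + 1) = -(-1) ^ k := by
    have h3 : (-1 : F) ^ (k + 1 + j) = -1 := hodd.neg_one_pow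
    have h4 : ((-1 : F) ^ k) * (-1) ^ k = 1 := by rw [← mul_pow]; simp
    have h5 : (-1 : F) ^ (k + 1 + j) = (-1) ^ k * (-1) ^ (j + 1) := by ring
    rw [h5] at h3
    linear_combination (-1 : F) ^ k * h3 - (-1 : F) ^ (j + 1) * h4
  rw [h2]
  ring

theorem exists_apply_eq (h : IsZigzag r s) {k : ℕ} (hk : k < r) :
    (∃ i < 2 * r, s (i : ℤ) = k + 1) ∧ ∃ i < 2 * r, s (i : ℤ) = -(k + 1) := by
  have h1 := h.apply_of_lt k hk
  have h2 := h.apply_reflect hk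
  rcases Nat.even_or_odd k with he | ho
  · rw [he.neg_one_pow, one_mul] at h1 h2
    exact ⟨⟨k, by omega, h1⟩, ⟨_, by omega, h2⟩⟩
  · rw [ho.neg_one_pow, neg_one_mul] at h1 h2
    rw [neg_neg] at h2
    exact ⟨⟨_, by omega, h2⟩, ⟨k, by omega, h1⟩⟩

theorem range_eq {p : ℕ} [Fact p.Prime] {s : ℤ → ZMod p} (h : IsZigzag r s)
    (hp : p = 2 * r + 1) :
    (Set.range fun i : Fin (2 * r) => s ((i : ℕ) : ℤ)) = {x : ZMod p | x ≠ 0} := by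
  ext x
  simp only [Set.mem_range, Set.mem_ofPred_eq]
  constructor
  · rintro ⟨⟨i, hi⟩, rfl⟩
    have hpow (k : ℕ) : (-1 : ZMod p) ^ k ≠ 0 := pow_ne_zero _ (neg_ne_zero.2 one_ne_zero)
    rcases Nat.lt_or_ge i r with hir | hir
    · rw [h.apply_of_lt i hir]
      exact mul_ne_zero (hpow i) (natCast_succ_ne_zero hp hir)
    · have hk : 2 * r - 1 - i < r := by omega
      have := h.apply_reflect hk
      rw [show 2 * r - 1 - (2 * r - 1 - i) = i by omega] at this
      rw [this]
      exact neg_ne_zero.2 (mul_ne_zero (hpow _) (natCast_succ_ne_zero hp hk))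
  · intro hx
    have hv0 : x.val ≠ 0 := (ZMod.val_ne_zero x).2 hx
    have hvp := ZMod.val_lt x
    have hxv := ZMod.natCast_zmod_val x
    rcases Nat.lt_or_ge r x.val with hv | hv
    · obtain ⟨i, hi, hsi⟩ := (h.exists_apply_eq (k := p - x.val - 1) (by omega)).2
      refine ⟨⟨i, hi⟩, hsi.trans ?_⟩
      have h1 : ((p - x.val - 1 + 1 + x.val : ℕ) : ZMod p) = 0 := by
        rw [show p - x.val - 1 + 1 + x.val = p by omega, ZMod.natCast_self]
      rw [Nat.cast_add, hxv, Nat.cast_succ] at h1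
      exact neg_eq_of_add_eq_zero_right h1
    · obtain ⟨i, hi, hsi⟩ := (h.exists_apply_eq (k := x.val - 1) (by omega)).1
      refine ⟨⟨i, hi⟩, hsi.trans ?_⟩
      rw [← Nat.cast_succ, Nat.succ_eq_add_one, Nat.sub_add_cancel (by omega), hxv]

theorem injective {p : ℕ} [Fact p.Prime] {s : ℤ → ZMod p} (h : IsZigzag r s)
    (hp : p = 2 * r + 1) : Function.Injective fun i : Fin (2 * r) => s ((i : ℕ) : ℤ) := by
  rw [← Set.injOn_univ, ← Set.ncard_image_iff, Set.image_univ, h.range_eq hp,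
    show {x : ZMod p | x ≠ 0} = {0}ᶜ from rfl, Set.ncard_compl, Set.ncard_singleton,
    Set.ncard_univ, Nat.card_zmod, Nat.card_eq_fintype_card, Fintype.card_fin, hp]
  rfl

end IsZigzag

end ZigzagSequence

theorem splits_X_pow_card_sub_one (p : ℕ) [Fact p.Prime] :
    (X ^ (p - 1) - 1 : (ZMod p)[X]).Splits := by
  have h := FiniteField.splits_X_pow_card_sub_X (K := ZMod p) p
  have hp := (Fact.out : p.Prime).pos
  simp only [Polynomial.map_sub, Polynomial.map_pow, map_X, ZMod.card] at h
  refine h.of_dvd (FiniteField.X_pow_card_sub_X_ne_zero _ (Fact.out : p.Prime).one_lt) ⟨X, ?_⟩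
  rw [sub_mul, ← pow_succ, Nat.sub_add_cancel hp, one_mul]

/-- Let `p ≡ 3 (mod 4)` be a prime, `p ≥ 7`, and `m = p - 1 = 2r` with `r ≥ 3` odd. The
period-`m` sequence `s` over `F_p` with values `1, -2, 3, …, -(r-1), r, -r, r-1, …, 2, -1`
enumerates `F_p^*`; the `m`-th cyclotomic polynomial over `F_p` divides its associated
polynomial `s̃`, and the minimal recursion of `s` is
`f(x) = (x + 1)(x^r - 1)/(x - 1) = (x + 1)(x^{r-1} + ⋯ + x + 1)`, which divides
`(x^m - 1)/((x - 1)·Φ_m(x))`. Hence `F_p^*` is an automatically non-standard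
`f`-subgroup. -/
theorem units_zmod_automatically_nonstandard (p : ℕ) [hp : Fact p.Prime]
    (hp4 : p % 4 = 3) (hp7 : 7 ≤ p)
    (r m : ℕ) (hm : m = p - 1) (hm2r : m = 2 * r) (hrodd : Odd r) (hr3 : 3 ≤ r)
    (s : ℤ → ZMod p)
    (hs : ∀ n : ℤ, s n =
      if h : ((n % (m : ℤ)).toNat) < r then
        (-1 : ZMod p) ^ ((n % (m : ℤ)).toNat) * (((n % (m : ℤ)).toNat : ZMod p) + 1)
      else
        (-1 : ZMod p) ^ (((n % (m : ℤ)).toNat - r) + 1) *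
          ((r : ZMod p) - (((n % (m : ℤ)).toNat - r : ℕ) : ZMod p)))
    (f : Polynomial (ZMod p)) (hf : f = (X + 1) * ∑ i ∈ Finset.range r, X ^ i) :
    (Set.range fun i : Fin m => s ((i : ℕ) : ℤ)) = {x : ZMod p | x ≠ 0} ∧
    (Function.Injective fun i : Fin m => s ((i : ℕ) : ℤ)) ∧
    (∀ n : ℤ, s (n + m) = s n) ∧
    cyclotomic m (ZMod p) ∣ (∑ i ∈ Finset.range m, C (s i) * X ^ (m - 1 - i)) ∧
    (∀ g : Polynomial (ZMod p), lrsApply g s = 0 ↔ f ∣ g) ∧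
    f ∣ (X ^ m - 1) / ((X - 1) * cyclotomic m (ZMod p)) := by
  subst hm2r
  have hp2 : p = 2 * r + 1 := by omega
  have hr0 : 0 < r := by omega
  have hper (n : ℤ) : s (n + (2 * r : ℕ)) = s n := by
    rw [hs, hs n]
    simp only [Int.add_emod_right]
  have hz : IsZigzag r s := by
    refine ⟨hrodd, hper, fun k hk => ?_, fun k hk => ?_⟩
    · have h1 : ((k : ℤ) % ((2 * r : ℕ) : ℤ)).toNat = k := by
        rw [← Int.natCast_mod, Int.toNat_natCast, Nat.mod_eq_of_lt (by omega)]
      rw [hs, h1, dif_pos hk]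
    · have h1 : (((r : ℤ) + k) % ((2 * r : ℕ) : ℤ)).toNat = r + k := by
        rw [← Nat.cast_add, ← Int.natCast_mod, Int.toNat_natCast, Nat.mod_eq_of_lt (by omega)]
      rw [hs, h1, dif_neg (by omega), Nat.add_sub_cancel_left]
  have h2r : ((2 * r : ℕ) : ZMod p) = -1 := by
    have h1 : ((2 * r + 1 : ℕ) : ZMod p) = 0 := by rw [← hp2, ZMod.natCast_self]
    rw [Nat.cast_succ] at h1
    exact eq_neg_of_add_eq_zero_left h1
  have hm0 : ((2 * r : ℕ) : ZMod p) ≠ 0 := by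
    rw [h2r]
    exact neg_ne_zero.2 one_ne_zero
  have hr0' : (r : ZMod p) ≠ 0 := fun h0 => hm0 (by rw [Nat.cast_mul, h0, mul_zero])
  have htwo : (2 : ZMod p) ≠ 0 := fun h0 => hm0 (by rw [Nat.cast_mul, Nat.cast_two, h0, zero_mul])
  have hsplit : (X ^ (2 * r) - 1 : (ZMod p)[X]).Splits := hm ▸ splits_X_pow_card_sub_one p
  have hdvd : (X - 1) * cyclotomic (2 * r) (ZMod p) * f ∣ X ^ (2 * r) - 1 :=
    hf ▸ cyclotomic_mul_dvd hrodd hr3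
  refine ⟨hz.range_eq hp2, hz.injective hp2, hper, ?_, fun g => ⟨fun hg => ?_, ?_⟩, ?_⟩
  · refine dvd_of_dvd_X_pow_sub_one hm0 hsplit (cyclotomic.dvd_X_pow_sub_one _ _) fun z hzr => ?_
    have : NeZero ((2 * r : ℕ) : ZMod p) := ⟨hm0⟩
    have hprim : IsPrimitiveRoot z (2 * r) := isRoot_cyclotomic_iff.1 hzr
    have hzm := hprim.pow_eq_one
    have hzr1 : z ^ r ≠ 1 := hprim.pow_ne_one_of_pos_of_lt (by omega) (by omega)
    have hzn : z + 1 ≠ 0 := fun h0 => hprim.pow_ne_one_of_pos_of_lt (l := 2) (by omega) (by omega)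
      (by rw [eq_neg_of_add_eq_zero_left h0]; ring)
    have hzr2 : z ^ r + 1 = 0 := by
      have h1 : (z ^ r - 1) * (z ^ r + 1) = 0 := by
        linear_combination hzm
      exact (mul_eq_zero.1 h1).resolve_left (sub_ne_zero.2 hzr1)
    have h2 := hz.sq_mul_periodSum hzm
    rw [hzr2, zero_mul] at h2
    have h3 := (mul_eq_zero.1 h2).resolve_left (pow_ne_zero 2 hzn)
    simpa [IsRoot, eval_finsetSum, periodSum_apply] using h3
  · refine dvd_of_dvd_X_pow_sub_one hm0 hsplit ((dvd_mul_left _ _).trans hdvd) fun z hzf => ?_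
    have hf1 : (X - 1) * f = (X + 1) * (X ^ r - 1) := by
      rw [hf, ← geom_sum_mul]
      ring
    have hzm : z ^ (2 * r) = 1 := by
      have h1 := hzf.dvd ((dvd_mul_left _ _).trans hdvd)
      simpa [IsRoot, sub_eq_zero] using h1
    have h0 := periodSum_lrsApply hzm hper g
    rw [hg, map_zero] at h0
    refine (mul_eq_zero.1 h0.symm).resolve_right fun hA => ?_
    have hz1 : z ≠ 1 := by
      rintro rfl
      simp [IsRoot, hf, hr0', one_add_one_eq_two, htwo] at hzf
    have h1 : (z + 1) * (z ^ r - 1) = 0 := by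
      have := congrArg (eval z) hf1
      rw [eval_mul, hzf.eq_zero, mul_zero] at this
      simpa using this.symm
    rcases mul_eq_zero.1 h1 with h1 | h1
    · rw [eq_neg_of_add_eq_zero_left h1, hz.periodSum_neg_one, neg_eq_zero] at hA
      refine (mul_ne_zero hr0' fun h2 => ?_) hA
      rw [Nat.cast_mul, eq_neg_of_add_eq_zero_left h2] at h2r
      refine one_ne_zero (α := ZMod p) ?_
      push_cast at h2r
      linear_combination -h2r
    · have h2 := hz.sq_mul_periodSum hzm
      rw [hA, mul_zero, sub_eq_zero.1 h1, one_add_one_eq_two] at h2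
      exact mul_ne_zero htwo (sub_ne_zero.2 hz1) h2.symm
  · rintro ⟨h, rfl⟩
    rw [lrsApply_eq_aeval, mul_comm, map_mul, Module.End.mul_apply, ← lrsApply_eq_aeval f, hf,
      hz.lrsApply_eq_zero, map_zero]
  · obtain ⟨c, hc⟩ := hdvd
    have hne : (X - 1) * cyclotomic (2 * r) (ZMod p) ≠ 0 :=
      mul_ne_zero (by simpa using X_sub_C_ne_zero (1 : ZMod p)) (cyclotomic_ne_zero _ _)
    rw [hc, mul_assoc, mul_div_cancel_left₀ _ hne]
    exact dvd_mul_right _ _
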